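/- Let n ≥ 3. Let B_n' be the set of rooted labelled trees (T, r') on [n] such that 1 is a leaf of T, 1 ≠ r', and 1 and n are not adjacent in T. Define the pairwise disjoint subsets A = {(T,r') ∈ B_n' : r' = n}, B' = {(T,r') ∈ B_n' : r' ≠ n, r' is adjacent to n in T, and n lies on the path in T from r' to 1 (i.e., 1 is a descendant of n)}, and B'' = {(T,r') ∈ B_n' : r' ≠ n and r' is not adjacent to n in T}. Then there is a bijection between U_n', the set of uprooted trees on [n] in which 1 and n are not adjacent, and A ∪ B' ∪ B''; in particular |U_n'| = |A| + |B'| + |B''|. -/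

import Mathlib

/-- A rooted labelled tree on the vertex set `Fin n` (representing `[n] = {1,…,n}`),
encoded by its parent function `par` and root `r`. -/
def IsRootedTree {n : ℕ} (par : Fin n → Fin n) (r : Fin n) : Prop :=
  par r = r ∧ ∀ i, ∃ k, par^[k] i = r

/-- An uprooted tree on `[n]`: a rooted labelled tree whose root is bigger than all its
neighbours. -/
def IsUprooted {n : ℕ} (par : Fin n → Fin n) (r : Fin n) : Prop :=
  IsRootedTree par r ∧ ∀ i, par i = r → i ≠ r → i < r

/-- The set `U_n'` of uprooted trees on `[n]` in which `v1` and `vn` (standing for the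
vertices `1` and `n`) are not adjacent. -/
def Unp (n : ℕ) (v1 vn : Fin n) : Set ((Fin n → Fin n) × Fin n) :=
  {p | IsUprooted p.1 p.2 ∧ ¬(p.1 v1 = vn ∨ p.1 vn = v1)}

open Function

section Counting

variable {α β : Type*}

theorem ncard_eq_of_inverse {s : Set α} {t : Set β} (f : α → β) (g : β → α)
    (hf : ∀ a ∈ s, f a ∈ t) (hg : ∀ b ∈ t, g b ∈ s) (hgf : ∀ a ∈ s, g (f a) = a)
    (hfg : ∀ b ∈ t, f (g b) = b) : s.ncard = t.ncard :=
  Set.BijOn.ncard_eq (f := f) (Set.InvOn.bijOn ⟨hgf, hfg⟩ hf hg)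

variable [Finite α]

theorem ncard_eq_sum_of_existsUnique (s : Set α) (I : Finset β) (P : β → α → Prop)
    (h : ∀ a ∈ s, ∃! b, b ∈ I ∧ P b a) :
    s.ncard = ∑ b ∈ I, {a ∈ s | P b a}.ncard := by
  classical
  have hs : s = ⋃ b ∈ (I : Set β), {a ∈ s | P b a} := by
    ext a
    simp only [Set.mem_iUnion, Set.mem_ofPred_eq, Finset.mem_coe, exists_prop]
    constructor
    · intro ha
      obtain ⟨b, hb, -⟩ := h a ha
      exact ⟨b, hb.1, ha, hb.2⟩
    · rintro ⟨b, -, ha, -⟩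
      exact ha
  have hdisj : (I : Set β).PairwiseDisjoint fun b => {a ∈ s | P b a} := by
    intro b hb c hc hbc
    refine Set.disjoint_left.2 fun a hab hac => hbc ?_
    exact (h a hab.1).unique ⟨hb, hab.2⟩ ⟨hc, hac.2⟩
  conv_lhs => rw [hs]
  rw [Set.Finite.ncard_biUnion I.finite_toSet (fun _ _ => Set.toFinite _) hdisj,
    finsum_mem_coe_finset]

theorem ncard_eq_sum_fiber (s : Set α) (I : Finset β) (f : α → β) (h : ∀ a ∈ s, f a ∈ I) :
    s.ncard = ∑ b ∈ I, {a ∈ s | f a = b}.ncard :=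
  ncard_eq_sum_of_existsUnique s I (fun b a => f a = b) fun a ha =>
    ⟨f a, ⟨h a ha, rfl⟩, fun _ hb => hb.2.symm⟩

theorem ncard_add_ncard_not (s : Set α) (P : α → Prop) :
    {a ∈ s | P a}.ncard + {a ∈ s | ¬P a}.ncard = s.ncard :=
  Set.ncard_inter_add_ncard_sdiff_eq_ncard s {a | P a}

end Counting

section Ancestor

variable {V : Type*}

/-- `u` lies on the forward orbit of `w` under `p`. -/
def IsAncestor (p : V → V) (w u : V) : Prop := ∃ k, p^[k] w = u

variable {p : V → V} {u v w x : V}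

theorem IsAncestor.refl (p : V → V) (w : V) : IsAncestor p w w := ⟨0, rfl⟩

theorem IsAncestor.head (h : IsAncestor p (p w) u) : IsAncestor p w u := by
  obtain ⟨k, hk⟩ := h
  exact ⟨k + 1, by simpa using hk⟩

theorem IsAncestor.tail (h : IsAncestor p w u) : IsAncestor p w (p u) := by
  obtain ⟨k, hk⟩ := h
  exact ⟨k + 1, by rw [iterate_succ_apply', hk]⟩

theorem IsAncestor.trans (h : IsAncestor p w u) (h' : IsAncestor p u v) : IsAncestor p w v := by
  obtain ⟨k, rfl⟩ := h
  obtain ⟨l, rfl⟩ := h'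
  exact ⟨l + k, iterate_add_apply ..⟩

theorem IsAncestor.total (h : IsAncestor p w u) (h' : IsAncestor p w v) :
    IsAncestor p u v ∨ IsAncestor p v u := by
  obtain ⟨k, rfl⟩ := h
  obtain ⟨l, rfl⟩ := h'
  rcases le_total k l with hkl | hkl
  · exact .inl ⟨l - k, by rw [← iterate_add_apply, Nat.sub_add_cancel hkl]⟩
  · exact .inr ⟨k - l, by rw [← iterate_add_apply, Nat.sub_add_cancel hkl]⟩

theorem IsAncestor.eq_of_fixed (h : IsAncestor p u v) (hu : p u = u) : v = u := by
  obtain ⟨k, rfl⟩ := h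
  exact iterate_fixed hu k

theorem IsAncestor.eq_of_fixed_of_fixed (h : IsAncestor p w u) (h' : IsAncestor p w v)
    (hu : p u = u) (hv : p v = v) : u = v := by
  rcases h.total h' with h | h
  · exact (h.eq_of_fixed hu).symm
  · exact h.eq_of_fixed hv

theorem isAncestor_iff_eq_or : IsAncestor p w u ↔ w = u ∨ IsAncestor p (p w) u := by
  constructor
  · rintro ⟨_ | k, hk⟩
    · exact .inl hk
    · exact .inr ⟨k, hk⟩
  · rintro (rfl | h)
    · exact .refl p w
    · exact h.head

theorem not_isAncestor_of_leaf (hx : ∀ j, j ≠ x → p j ≠ x) (hw : w ≠ x) :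
    ¬IsAncestor p w x := by
  rintro ⟨k, hk⟩
  induction k generalizing w with
  | zero => exact hw hk
  | succ k ih => exact ih (hx w hw) hk

theorem isAncestor_conj_iff (σ : Equiv.Perm V) :
    IsAncestor (σ ∘ p ∘ σ.symm) (σ w) (σ u) ↔ IsAncestor p w u := by
  have h : Semiconj σ p (σ ∘ p ∘ σ.symm) := fun x => by simp
  refine exists_congr fun k => ?_
  rw [← (h.iterate_right k).eq, σ.injective.eq_iff]

variable [DecidableEq V]

theorem IsAncestor.update_self (h : IsAncestor p w v) : IsAncestor (update p v x) w v := by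
  obtain ⟨k, hk⟩ := h
  induction k generalizing w with
  | zero => exact ⟨0, hk⟩
  | succ k ih =>
    by_cases hw : w = v
    · exact ⟨0, hw⟩
    · refine IsAncestor.head ?_
      rw [update_of_ne hw]
      exact ih hk

theorem isAncestor_update_self_iff : IsAncestor (update p v x) w v ↔ IsAncestor p w v := by
  refine ⟨fun h => ?_, IsAncestor.update_self⟩
  simpa using h.update_self (x := p v)

theorem IsAncestor.update_of_not (h : IsAncestor p w u) (hv : ¬IsAncestor p w v) :
    IsAncestor (update p v x) w u := by
  obtain ⟨k, hk⟩ := h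
  induction k generalizing w with
  | zero => exact ⟨0, hk⟩
  | succ k ih =>
    have hw : w ≠ v := by
      rintro rfl
      exact hv (.refl p w)
    refine IsAncestor.head ?_
    rw [update_of_ne hw]
    exact ih (fun h => hv h.head) hk

end Ancestor

section RootedTree

variable {n : ℕ} {p : Fin n → Fin n} {r u v w x : Fin n}

theorem IsRootedTree.isAncestor (h : IsRootedTree p r) (i : Fin n) : IsAncestor p i r := h.2 i

theorem IsRootedTree.not_isAncestor_apply (h : IsRootedTree p r) (hv : v ≠ r) :
    ¬IsAncestor p (p v) v := by
  rintro ⟨k, hk⟩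
  obtain ⟨j, hj⟩ := h.2 v
  have hper : IsPeriodicPt p (k + 1) v := hk
  have h1 : p^[(k + 1) * j] v = v := hper.mul_const j
  have h2 : p^[(k + 1) * j] v = r := by
    rw [show (k + 1) * j = k * j + j by ring, iterate_add_apply, hj, iterate_fixed h.1]
  exact hv (h1.symm.trans h2)

theorem IsRootedTree.not_isAncestor_root (h : IsRootedTree p r) (hv : v ≠ r) :
    ¬IsAncestor p r v := fun hr => hv (hr.eq_of_fixed h.1)

theorem IsRootedTree.update (h : IsRootedTree p r) (hv : v ≠ r) (hx : ¬IsAncestor p x v) :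
    IsRootedTree (update p v x) r := by
  refine ⟨by rw [update_of_ne hv.symm, h.1], fun i => ?_⟩
  change IsAncestor _ i r
  by_cases hi : IsAncestor p i v
  · refine hi.update_self.trans (IsAncestor.head ?_)
    rw [update_self]
    exact (h.isAncestor x).update_of_not hx
  · exact (h.isAncestor i).update_of_not hi

theorem IsRootedTree.reroot (h : IsRootedTree p r) (v : Fin n) :
    IsRootedTree (Function.update (Function.update p r v) v v) v := by
  refine ⟨by simp, fun i => ?_⟩
  change IsAncestor _ i v
  refine IsAncestor.update_self ?_
  have := ((h.isAncestor i).update_self (x := v)).tail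
  rwa [update_self] at this

/-- Parent functions of trees with root `r` in which the children of `r` form the set `S`. -/
def treesWithChildren (r : Fin n) (S : Finset (Fin n)) : Set (Fin n → Fin n) :=
  {p | IsRootedTree p r ∧ ∀ i, i ≠ r → (p i = r ↔ i ∈ S)}

variable {S : Finset (Fin n)}

theorem exists_child_isAncestor (hp : p ∈ treesWithChildren r S) (hw : w ≠ r) :
    ∃ u ∈ S, IsAncestor p w u := by
  obtain ⟨k, hk⟩ := hp.1.2 w
  induction k generalizing w with
  | zero => exact absurd hk hw
  | succ k ih =>
    by_cases h : p w = r
    · exact ⟨w, (hp.2 w hw).1 h, .refl p w⟩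
    · obtain ⟨u, hu, hwu⟩ := ih h hk
      exact ⟨u, hu, hwu.head⟩

theorem eq_of_isAncestor_of_mem (hp : p ∈ treesWithChildren r S) (hr : r ∉ S) (hu : u ∈ S)
    (h : IsAncestor p u v) (hv : v ∈ S) : u = v := by
  have hur : u ≠ r := fun h => hr (h ▸ hu)
  have hvr : v ≠ r := fun h => hr (h ▸ hv)
  rcases isAncestor_iff_eq_or.1 h with h | h
  · exact h
  · rw [(hp.2 u hur).2 hu] at h
    exact absurd h (hp.1.not_isAncestor_root hvr)

theorem existsUnique_child_isAncestor (hp : p ∈ treesWithChildren r S) (hr : r ∉ S)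
    (hw : w ≠ r) : ∃! u, u ∈ S ∧ IsAncestor p w u := by
  obtain ⟨u, hu, hwu⟩ := exists_child_isAncestor hp hw
  refine ⟨u, ⟨hu, hwu⟩, ?_⟩
  rintro v ⟨hv, hwv⟩
  rcases hwu.total hwv with h | h
  · exact (eq_of_isAncestor_of_mem hp hr hu h hv).symm
  · exact eq_of_isAncestor_of_mem hp hr hv h hu

theorem conj_mem_treesWithChildren {σ : Equiv.Perm (Fin n)} (hσr : σ r = r)
    (hσS : ∀ i, σ i ∈ S ↔ i ∈ S) (hp : p ∈ treesWithChildren r S) :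
    σ ∘ p ∘ σ.symm ∈ treesWithChildren r S := by
  have hσr' : σ.symm r = r := by rw [Equiv.symm_apply_eq, hσr]
  refine ⟨⟨by simp [hσr', hp.1.1, hσr], fun i => ?_⟩, fun i hi => ?_⟩
  · have := (isAncestor_conj_iff σ).2 (hp.1.isAncestor (σ.symm i))
    rwa [hσr, Equiv.apply_symm_apply] at this
  · have hi' : σ.symm i ≠ r := by rwa [Ne, Equiv.symm_apply_eq, hσr]
    have := hp.2 _ hi'
    rw [← hσS, Equiv.apply_symm_apply] at this
    rw [← this, comp_apply, comp_apply, ← Equiv.eq_symm_apply, hσr']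

theorem ncard_isAncestor_eq (hr : r ∉ S) (hwS : w ∉ S) (hu : u ∈ S) (hv : v ∈ S) :
    {p ∈ treesWithChildren r S | IsAncestor p w u}.ncard =
      {p ∈ treesWithChildren r S | IsAncestor p w v}.ncard := by
  have hne : ∀ {x}, x ∈ S → x ≠ r ∧ x ≠ w := fun hx =>
    ⟨fun h => hr (h ▸ hx), fun h => hwS (h ▸ hx)⟩
  set σ := Equiv.swap u v with hσ
  have hσσ : σ.symm = σ := Equiv.symm_swap u v
  have hσr : σ r = r := Equiv.swap_apply_of_ne_of_ne (hne hu).1.symm (hne hv).1.symm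
  have hσw : σ w = w := Equiv.swap_apply_of_ne_of_ne (hne hu).2.symm (hne hv).2.symm
  have hσS : ∀ i, σ i ∈ S ↔ i ∈ S := by
    intro i
    rw [hσ, Equiv.swap_apply_def]
    split_ifs <;> simp_all
  have hinv : ∀ p : Fin n → Fin n, σ ∘ (σ ∘ p ∘ σ.symm) ∘ σ.symm = p := by
    intro p
    ext i
    simp [hσ]
  refine ncard_eq_of_inverse (fun p => σ ∘ p ∘ σ.symm) (fun p => σ ∘ p ∘ σ.symm) ?_ ?_
    (fun p _ => hinv p) (fun p _ => hinv p)
  · rintro p ⟨hp, h⟩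
    refine ⟨conj_mem_treesWithChildren hσr hσS hp, ?_⟩
    have := (isAncestor_conj_iff σ).2 h
    rwa [hσw, show σ u = v from Equiv.swap_apply_left u v] at this
  · rintro p ⟨hp, h⟩
    refine ⟨conj_mem_treesWithChildren hσr hσS hp, ?_⟩
    have := (isAncestor_conj_iff σ).2 h
    rwa [hσw, show σ v = u from Equiv.swap_apply_right u v] at this

theorem card_mul_ncard_isAncestor (hr : r ∉ S) (hw : w ≠ r) (hwS : w ∉ S) (hu : u ∈ S) :
    S.card * {p ∈ treesWithChildren r S | IsAncestor p w u}.ncard =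
      (treesWithChildren r S).ncard := by
  rw [ncard_eq_sum_of_existsUnique (treesWithChildren r S) S (fun u p => IsAncestor p w u)
    fun p hp => existsUnique_child_isAncestor hp hr hw,
    Finset.sum_congr rfl fun v hv => ncard_isAncestor_eq hr hwS hv hu, Finset.sum_const,
    smul_eq_mul]

theorem card_mul_ncard_not_isAncestor (hr : r ∉ S) (hw : w ≠ r) (hwS : w ∉ insert v S)
    (hv : v ≠ r) (hvS : v ∉ S) :
    (S.card + 1) * {p ∈ treesWithChildren r (insert v S) | ¬IsAncestor p w v}.ncard =
      S.card * (treesWithChildren r (insert v S)).ncard := by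
  have h1 := card_mul_ncard_isAncestor (S := insert v S) (u := v)
    (by simp [hr, hv.symm]) hw hwS (by simp)
  have h2 := ncard_add_ncard_not (treesWithChildren r (insert v S)) (fun p => IsAncestor p w v)
  rw [Finset.card_insert_of_notMem hvS] at h1
  nlinarith

theorem ncard_not_isAncestor_of_mem (hr : r ∉ S) (hw : w ∈ S) (hv : v ≠ r) (hvS : v ∉ S) :
    {p ∈ treesWithChildren r (insert v S) | ¬IsAncestor p w v}.ncard =
      (treesWithChildren r (insert v S)).ncard := by
  congr 1
  refine Set.sep_eq_self_iff_mem_true.2 fun p hp h => hvS ?_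
  have := eq_of_isAncestor_of_mem hp (by simp [hr, hv.symm]) (Finset.mem_insert_of_mem hw) h
    (by simp)
  exact this ▸ hw

theorem ncard_apply_eq (hv : v ≠ r) (hvS : v ∉ S) (hw : w ≠ r) :
    {p ∈ treesWithChildren r S | p v = w}.ncard =
      {p ∈ treesWithChildren r (insert v S) | ¬IsAncestor p w v}.ncard := by
  refine ncard_eq_of_inverse (fun p => update p v r) (fun p => update p v w) ?_ ?_ ?_ ?_
  · rintro p ⟨hp, rfl⟩
    refine ⟨⟨hp.1.update hv (hp.1.not_isAncestor_root hv), fun i hi => ?_⟩, ?_⟩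
    · by_cases hiv : i = v
      · simp [hiv]
      · simp [hiv, hp.2 i hi]
    · rw [isAncestor_update_self_iff]
      exact hp.1.not_isAncestor_apply hv
  · rintro p ⟨hp, hwv⟩
    refine ⟨⟨hp.1.update hv hwv, fun i hi => ?_⟩, by simp⟩
    by_cases hiv : i = v
    · simp [hiv, hw, hvS]
    · simp [hiv, hp.2 i hi]
  · rintro p ⟨hp, rfl⟩
    simp
  · rintro p ⟨hp, -⟩
    have : p v = r := (hp.2 v hv).2 (by simp)
    simp [← this]

theorem ncard_treesWithChildren_mul (hr : r ∉ S) (hv : v ≠ r) (hvS : v ∉ S) :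
    (S.card + 1) * (treesWithChildren r S).ncard =
      S.card * (n - 1) * (treesWithChildren r (insert v S)).ncard := by
  have hsum := ncard_eq_sum_fiber (treesWithChildren r S) (Finset.univ.erase r) (fun p => p v)
    (fun p hp => by simpa using fun h => hvS ((hp.2 v hv).1 h))
  rw [Finset.sum_congr rfl fun w hw => ncard_apply_eq hv hvS (Finset.ne_of_mem_erase hw)] at hsum
  have hsub : insert v S ⊆ Finset.univ.erase r := by
    intro i hi
    simp only [Finset.mem_erase, Finset.mem_univ, and_true]
    rintro rfl
    simp_all
  have hcard : (Finset.univ.erase r \ insert v S).card + (S.card + 1) = n - 1 := by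
    rw [← Finset.card_insert_of_notMem hvS, Finset.card_sdiff_add_card_eq_card hsub]
    simp
  rw [← Finset.sum_sdiff hsub, Finset.sum_insert hvS,
    Finset.sum_congr rfl fun w hw => ncard_not_isAncestor_of_mem hr hw hv hvS,
    Finset.sum_const, smul_eq_mul] at hsum
  have hzero : {p ∈ treesWithChildren r (insert v S) | ¬IsAncestor p v v}.ncard = 0 := by
    simp [IsAncestor.refl]
  rw [hsum, hzero, ← hcard, mul_add, Finset.mul_sum,
    Finset.sum_congr rfl fun w hw => card_mul_ncard_not_isAncestor hr
      (Finset.ne_of_mem_erase (Finset.mem_sdiff.1 hw).1) (Finset.mem_sdiff.1 hw).2 hv hvS,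
    Finset.sum_const, smul_eq_mul]
  ring

theorem ncard_treesWithChildren_compl (r : Fin n) :
    (treesWithChildren r (Finset.univ.erase r)).ncard = 1 := by
  rw [Set.ncard_eq_one]
  refine ⟨fun _ => r, ?_⟩
  ext p
  simp only [Set.mem_singleton_iff]
  constructor
  · intro hp
    ext1 i
    by_cases hi : i = r
    · rw [hi, hp.1.1]
    · exact (hp.2 i hi).2 (by simpa using hi)
  · rintro rfl
    exact ⟨⟨rfl, fun i => ⟨1, rfl⟩⟩, fun i hi => by simpa using hi⟩

theorem ncard_treesWithChildren (hn : 2 ≤ n) (hr : r ∉ S) :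
    ((treesWithChildren r S).ncard : ℚ) =
      S.card * ((n - 1 : ℕ) : ℚ) ^ (n - 2) * (((n - 1 : ℕ) : ℚ)⁻¹) ^ S.card := by
  have hm : ((n - 1 : ℕ) : ℚ) ≠ 0 := by
    have : n - 1 ≠ 0 := by omega
    exact_mod_cast this
  obtain ⟨k, hk⟩ : ∃ k, k = (Finset.univ.erase r \ S).card := ⟨_, rfl⟩
  induction k generalizing S with
  | zero =>
    have hS : S = Finset.univ.erase r := by
      refine Finset.Subset.antisymm (fun i hi => ?_) ?_
      · simpa using fun h : i = r => hr (h ▸ hi)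
      · rw [← Finset.sdiff_eq_empty_iff_subset, ← Finset.card_eq_zero, ← hk]
    rw [hS, ncard_treesWithChildren_compl, Finset.card_erase_of_mem (Finset.mem_univ r),
      Finset.card_univ, Fintype.card_fin, mul_comm (((n - 1 : ℕ) : ℚ)), ← pow_succ,
      show n - 2 + 1 = n - 1 by omega, ← mul_pow, mul_inv_cancel₀ hm]
    simp
  | succ k ih =>
    obtain ⟨v, hv⟩ : (Finset.univ.erase r \ S).Nonempty := by
      rw [← Finset.card_pos]
      omega
    obtain ⟨hvr, hvS⟩ := Finset.mem_sdiff.1 hv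
    replace hvr := Finset.ne_of_mem_erase hvr
    have hcard : (Finset.univ.erase r \ insert v S).card = k := by
      rw [Finset.sdiff_insert, Finset.card_erase_of_mem hv]
      omega
    have h1 := ih (S := insert v S) (by simp [hr, hvr.symm]) hcard.symm
    have h2 : ((S.card : ℚ) + 1) * (treesWithChildren r S).ncard =
        S.card * ((n - 1 : ℕ) : ℚ) * (treesWithChildren r (insert v S)).ncard := by
      exact_mod_cast ncard_treesWithChildren_mul hr hvr hvS
    rw [h1, Finset.card_insert_of_notMem hvS] at h2
    have hs : (S.card : ℚ) + 1 ≠ 0 := by positivity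
    apply mul_left_cancel₀ hs
    rw [h2, pow_succ]
    push_cast
    field_simp

end RootedTree

section LeafTrees

variable {n : ℕ} {p : Fin n → Fin n} {r a b q : Fin n}

/-- Parent functions of trees with root `r` in which no vertex has parent `a`, and the parent
of `a` is not `b`. -/
def leafTrees (a b r : Fin n) : Set (Fin n → Fin n) :=
  {p | IsRootedTree p r ∧ (∀ i, i ≠ a → p i ≠ a) ∧ p a ≠ b}

theorem ncard_leaf_apply_eq (hr : r ≠ a) (hq : q ≠ a) :
    {p | IsRootedTree p r ∧ (∀ i, i ≠ a → p i ≠ a) ∧ p a = q}.ncard =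
      (treesWithChildren a {r}).ncard := by
  refine ncard_eq_of_inverse (fun p => update (update p r a) a a)
    (fun p => update (update p r r) a q) ?_ ?_ ?_ ?_
  · rintro p ⟨hp, hleaf, -⟩
    refine ⟨hp.reroot a, fun i hi => ?_⟩
    by_cases hir : i = r
    · simp [hir, hr]
    · simp [hi, hir, hleaf i hi]
  · intro p hp
    have hleaf : ∀ i, i ≠ a → update p r r i ≠ a := by
      intro i hi
      by_cases hir : i = r
      · simpa [hir] using hr
      · simpa [hir] using (hp.2 i hi).not.2 (by simpa using hir)
    have hreach : ∀ i, i ≠ a → IsAncestor (update (update p r r) a q) i r := by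
      intro i hi
      obtain ⟨u, hu, hiu⟩ := exists_child_isAncestor hp hi
      rw [Finset.mem_singleton.1 hu] at hiu
      exact hiu.update_self.update_of_not (not_isAncestor_of_leaf hleaf hi)
    refine ⟨⟨by simp [hr], fun i => ?_⟩, fun i hi => ?_, by simp⟩
    · by_cases hi : i = a
      · refine IsAncestor.head ?_
        rw [hi, update_self]
        exact hreach q hq
      · exact hreach i hi
    · rw [update_of_ne hi]
      exact hleaf i hi
  · rintro p ⟨hp, -, rfl⟩
    ext1 i
    by_cases hi : i = a
    · simp [hi]
    · by_cases hir : i = r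
      · simp [hir, hr, hp.1]
      · simp [hi, hir]
  · intro p hp
    ext1 i
    by_cases hi : i = a
    · simp [hi, hp.1.1]
    · by_cases hir : i = r
      · simpa [hir, hr] using ((hp.2 r hr).2 (by simp)).symm
      · simp [hi, hir]

theorem card_univ_sdiff_pair (hab : a ≠ b) :
    (Finset.univ \ {a, b} : Finset (Fin n)).card = n - 2 := by
  rw [Finset.card_univ_sdiff, Finset.card_pair hab, Fintype.card_fin]

theorem ncard_leafTrees (hab : a ≠ b) (hr : r ≠ a) :
    (leafTrees a b r).ncard = (n - 2) * (n - 1) ^ (n - 3) := by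
  rw [ncard_eq_sum_fiber (leafTrees a b r) (Finset.univ \ {a, b}) (fun p => p a),
    Finset.sum_congr rfl (g := fun _ => (n - 1) ^ (n - 3)), Finset.sum_const,
    card_univ_sdiff_pair hab, smul_eq_mul]
  · intro q hq
    simp only [Finset.mem_sdiff, Finset.mem_univ, Finset.mem_insert, Finset.mem_singleton,
      not_or, true_and] at hq
    have hn : n - 2 ≠ 0 := by
      rw [← card_univ_sdiff_pair hab]
      exact Finset.card_ne_zero_of_mem (a := q) (by simpa using hq)
    have hm : ((n - 1 : ℕ) : ℚ) ≠ 0 := by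
      have : n - 1 ≠ 0 := by omega
      exact_mod_cast this
    have hset : {p ∈ leafTrees a b r | p a = q} =
        {p | IsRootedTree p r ∧ (∀ i, i ≠ a → p i ≠ a) ∧ p a = q} := by
      ext p
      constructor
      · rintro ⟨⟨h1, h2, -⟩, h3⟩
        exact ⟨h1, h2, h3⟩
      · rintro ⟨h1, h2, h3⟩
        exact ⟨⟨h1, h2, h3 ▸ hq.2⟩, h3⟩
    rw [hset, ncard_leaf_apply_eq hr hq.1]
    have h := ncard_treesWithChildren (r := a) (S := {r}) (by omega) (by simpa using hr.symm)
    rw [show n - 2 = n - 3 + 1 by omega, pow_succ] at h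
    simp only [Finset.card_singleton, Nat.cast_one, one_mul, pow_one,
      mul_inv_cancel_right₀ hm] at h
    exact_mod_cast h
  · rintro p ⟨hp, hleaf, hpa⟩
    simp only [Finset.mem_sdiff, Finset.mem_univ, Finset.mem_insert, Finset.mem_singleton,
      not_or, true_and]
    refine ⟨fun h => ?_, hpa⟩
    exact hr ((hp.isAncestor a).eq_of_fixed h)

theorem ncard_isAncestor_reroot (hab : a ≠ b) (hra : r ≠ a) (hrb : r ≠ b) :
    {p ∈ leafTrees a b r | p b = r ∧ ¬IsAncestor p a b}.ncard =
      {p ∈ leafTrees a b b | p r = b ∧ IsAncestor p a r}.ncard := by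
  refine ncard_eq_of_inverse (fun p => update (update p r b) b b)
    (fun p => update (update p b r) r r) ?_ ?_ ?_ ?_
  · rintro p ⟨⟨hp, hleaf, hpa⟩, hbr, hanc⟩
    refine ⟨⟨hp.reroot b, fun i hi => ?_, by simpa [hab, hra.symm]⟩, by simp [hrb], ?_⟩
    · have := hleaf i hi
      grind [Function.update_apply]
    · rw [update_comm hrb]
      exact ((hp.isAncestor a).update_of_not hanc).update_self
  · rintro p ⟨⟨hp, hleaf, hpa⟩, hrb', hanc⟩
    have hanc' : ¬IsAncestor (update (update p b r) r r) a b := by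
      rw [update_comm hrb.symm, isAncestor_update_self_iff]
      intro h
      exact hrb ((hanc.update_self (x := r)).eq_of_fixed_of_fixed h (by simp)
        (by simp [hrb.symm, hp.1]))
    refine ⟨⟨hp.reroot r, fun i hi => ?_, fun h => hanc' ?_⟩, by simp [hrb.symm], hanc'⟩
    · have := hleaf i hi
      grind [Function.update_apply]
    · refine IsAncestor.head ?_
      rw [h]
      exact .refl _ _
  · rintro p ⟨⟨hp, -, -⟩, hbr, -⟩
    have := hp.1
    ext1 i
    grind [Function.update_apply]
  · rintro p ⟨⟨hp, -, -⟩, hbr, -⟩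
    have := hp.1
    ext1 i
    grind [Function.update_apply]

theorem sum_ncard_not_isAncestor (hab : a ≠ b) :
    ∑ r ∈ Finset.univ \ {a, b}, {p ∈ leafTrees a b r | p b = r ∧ ¬IsAncestor p a b}.ncard =
      (leafTrees a b b).ncard := by
  rw [ncard_eq_sum_of_existsUnique (leafTrees a b b) (Finset.univ \ {a, b})
    (fun r p => p r = b ∧ IsAncestor p a r)]
  · refine Finset.sum_congr rfl fun r hr => ?_
    simp only [Finset.mem_sdiff, Finset.mem_univ, Finset.mem_insert, Finset.mem_singleton,
      not_or, true_and] at hr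
    exact ncard_isAncestor_reroot hab hr.1 hr.2
  · rintro p ⟨hp, -, hpa⟩
    have hmem : p ∈ treesWithChildren b {i | i ≠ b ∧ p i = b} :=
      ⟨hp, fun i hi => by simp [hi]⟩
    obtain ⟨u, ⟨hu, hau⟩, huniq⟩ := existsUnique_child_isAncestor hmem (by simp) hab
    simp only [Finset.mem_filter, Finset.mem_univ, true_and] at hu huniq
    refine ⟨u, ⟨?_, hu.2, hau⟩, ?_⟩
    · have : u ≠ a := by
        rintro rfl
        exact hpa hu.2
      simp [this, hu.1]
    · rintro v ⟨hv, hvb, hav⟩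
      simp only [Finset.mem_sdiff, Finset.mem_univ, Finset.mem_insert, Finset.mem_singleton,
        not_or, true_and] at hv
      exact huniq v ⟨⟨hv.2, hvb⟩, hav⟩

/-- Trees in which `a` is a leaf other than the root and is not adjacent to `b`. -/
def leafPairs (a b : Fin n) : Set ((Fin n → Fin n) × Fin n) :=
  {x | IsRootedTree x.1 x.2 ∧ x.2 ≠ a ∧ (∀ i, i ≠ a → x.1 i ≠ a) ∧ ¬(x.1 a = b ∨ x.1 b = a)}

theorem ncard_sep_snd_eq {s : Set ((Fin n → Fin n) × Fin n)} {t : Set (Fin n → Fin n)}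
    (h : ∀ p, (p, r) ∈ s ↔ p ∈ t) : {x ∈ s | x.2 = r}.ncard = t.ncard := by
  refine ncard_eq_of_inverse Prod.fst (fun p => (p, r)) ?_ ?_ ?_ ?_
  · rintro ⟨p, _⟩ ⟨hp, rfl⟩
    exact (h p).1 hp
  · exact fun p hp => ⟨(h p).2 hp, rfl⟩
  · rintro ⟨p, _⟩ ⟨hp, rfl⟩
    rfl
  · exact fun p _ => rfl

theorem mem_leafPairs_iff (hab : a ≠ b) (hr : r ≠ a) :
    (p, r) ∈ leafPairs a b ↔ p ∈ leafTrees a b r := by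
  constructor
  · rintro ⟨h1, -, h3, h4⟩
    exact ⟨h1, h3, fun h => h4 (.inl h)⟩
  · rintro ⟨h1, h2, h3⟩
    exact ⟨h1, hr, h2, not_or.2 ⟨h3, h2 b hab.symm⟩⟩

theorem ncard_leafPairs (hab : a ≠ b) :
    (leafPairs a b).ncard = (n - 1) * ((n - 2) * (n - 1) ^ (n - 3)) := by
  rw [ncard_eq_sum_fiber (leafPairs a b) (Finset.univ.erase a) Prod.snd
    fun x hx => by simpa using hx.2.1]
  rw [Finset.sum_congr rfl fun r hr => (ncard_sep_snd_eq fun p =>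
    mem_leafPairs_iff hab (Finset.ne_of_mem_erase hr)).trans
      (ncard_leafTrees hab (Finset.ne_of_mem_erase hr))]
  simp

theorem ncard_leafPairs_root_eq (hab : a ≠ b) :
    {x ∈ leafPairs a b | x.2 = b}.ncard = (n - 2) * (n - 1) ^ (n - 3) := by
  rw [ncard_sep_snd_eq fun p => mem_leafPairs_iff hab hab.symm, ncard_leafTrees hab hab.symm]

theorem ncard_leafPairs_not_isAncestor (hab : a ≠ b) :
    {x ∈ leafPairs a b | x.2 ≠ b ∧ x.1 b = x.2 ∧ ¬IsAncestor x.1 a b}.ncard =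
      (n - 2) * (n - 1) ^ (n - 3) := by
  rw [← ncard_leafTrees hab hab.symm, ← sum_ncard_not_isAncestor hab,
    ncard_eq_sum_fiber _ (Finset.univ \ {a, b}) Prod.snd
      fun x hx => by simpa using ⟨hx.1.2.1, hx.2.1⟩]
  refine Finset.sum_congr rfl fun r hr => ncard_sep_snd_eq fun p => ?_
  simp only [Finset.mem_sdiff, Finset.mem_univ, Finset.mem_insert, Finset.mem_singleton,
    not_or, true_and] at hr
  change _ ∧ _ ↔ _ ∧ _
  rw [mem_leafPairs_iff hab hr.1]
  simp [hr.2]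

theorem ncard_leafPairs_add (hab : a ≠ b) :
    {x ∈ leafPairs a b | x.2 = b}.ncard +
      {x ∈ leafPairs a b | x.2 ≠ b ∧ (x.1 b = x.2 ∨ x.1 x.2 = b) ∧ IsAncestor x.1 a b}.ncard +
      {x ∈ leafPairs a b | x.2 ≠ b ∧ ¬(x.1 b = x.2 ∨ x.1 x.2 = b)}.ncard =
      (n - 2) ^ 2 * (n - 1) ^ (n - 3) := by
  have hroot : ∀ x ∈ leafPairs a b, x.2 ≠ b → x.1 x.2 ≠ b := fun x hx h => by rwa [hx.1.1]
  have h1 := ncard_add_ncard_not (leafPairs a b) (fun x => x.2 = b)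
  have h2 := ncard_add_ncard_not {x ∈ leafPairs a b | ¬x.2 = b}
    (fun x => x.1 b = x.2 ∨ x.1 x.2 = b)
  have h3 := ncard_add_ncard_not
    {x ∈ {x ∈ leafPairs a b | ¬x.2 = b} | x.1 b = x.2 ∨ x.1 x.2 = b}
    (fun x => IsAncestor x.1 a b)
  have h4 := ncard_leafPairs_not_isAncestor hab
  have h5 : {x ∈ {x ∈ {x ∈ leafPairs a b | ¬x.2 = b} | x.1 b = x.2 ∨ x.1 x.2 = b} |
      ¬IsAncestor x.1 a b} =
      {x ∈ leafPairs a b | x.2 ≠ b ∧ x.1 b = x.2 ∧ ¬IsAncestor x.1 a b} := by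
    ext x
    have := hroot x
    simp only [Set.mem_ofPred_eq]
    tauto
  rw [h5] at h3
  simp only [Set.mem_ofPred_eq, and_assoc] at h2 h3
  have h6 := ncard_leafPairs hab
  have h7 := ncard_leafPairs_root_eq hab
  have h8 : a.val ≠ b.val := fun h => hab (Fin.ext h)
  obtain ⟨N, rfl⟩ : ∃ N, n = N + 2 := ⟨n - 2, by omega⟩
  simp only [Nat.add_sub_cancel, show N + 2 - 1 = N + 1 by omega] at *
  simp only [Ne]
  have h9 : N ^ 2 * (N + 1) ^ (N + 2 - 3) + N * (N + 1) ^ (N + 2 - 3) =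
      (N + 1) * (N * (N + 1) ^ (N + 2 - 3)) := by ring
  simp only [Ne] at *
  omega

end LeafTrees

section PowersetSums

variable {α : Type*}

theorem sum_powerset_pow_card (y : ℚ) (X : Finset α) :
    ∑ S ∈ X.powerset, y ^ S.card = (1 + y) ^ X.card := by
  rw [add_comm, ← Finset.sum_pow_mul_eq_add_pow]
  simp

variable [DecidableEq α]

theorem one_add_mul_sum_powerset_card_mul_pow (y : ℚ) (X : Finset α) :
    (1 + y) * ∑ S ∈ X.powerset, S.card * y ^ S.card = X.card * y * (1 + y) ^ X.card := by
  induction X using Finset.induction_on with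
  | empty => simp
  | insert a X ha ih =>
    rw [Finset.sum_powerset_insert ha]
    have h : ∀ S ∈ X.powerset, ((insert a S).card : ℚ) * y ^ (insert a S).card =
        y * (S.card * y ^ S.card) + y * y ^ S.card := by
      intro S hS
      rw [Finset.card_insert_of_notMem fun h => ha (Finset.mem_powerset.1 hS h)]
      push_cast
      ring
    rw [Finset.sum_congr rfl h, Finset.sum_add_distrib, ← Finset.mul_sum, ← Finset.mul_sum,
      sum_powerset_pow_card, Finset.card_insert_of_notMem ha]
    push_cast
    linear_combination (1 + y) * ih

theorem sum_powerset_affine_mul_pow {y : ℚ} (hy : 0 < y) (s t : ℚ) (X : Finset α) :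
    ∑ S ∈ X.powerset, (s * S.card + t) * y ^ S.card =
      (1 + y) ^ X.card * (s * X.card * y / (1 + y) + t) := by
  have h : ∑ S ∈ X.powerset, (s * S.card + t) * y ^ S.card =
      s * ∑ S ∈ X.powerset, S.card * y ^ S.card + t * ∑ S ∈ X.powerset, y ^ S.card := by
    rw [Finset.mul_sum, Finset.mul_sum, ← Finset.sum_add_distrib]
    exact Finset.sum_congr rfl fun S _ => by ring
  have hz : 1 + y ≠ 0 := by positivity
  rw [h, sum_powerset_pow_card, eq_div_of_mul_eq hz
    ((mul_comm _ _).trans (one_add_mul_sum_powerset_card_mul_pow y X))]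
  field_simp

theorem sum_range_add_eq {y : ℚ} (hy : 0 < y) (K : ℕ) :
    ∑ j ∈ Finset.range K, (1 + y) ^ j * ((1 - y - y ^ 2) * j * y / (1 + y) + (y - 2 * y ^ 2)) +
      (1 + y) ^ K * (K * y / (1 + y)) =
      ((1 + y) ^ K * (1 - y) * (K * y - (1 - y)) + (1 - y) ^ 2) / y := by
  have hz : 1 + y ≠ 0 := by positivity
  induction K with
  | zero => simp; ring
  | succ K ih =>
    rw [Finset.sum_range_succ]
    rw [← eq_sub_iff_add_eq] at ih
    rw [ih]
    push_cast
    field_simp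
    ring

end PowersetSums

section Uprooted

variable {n : ℕ} {p : Fin n → Fin n} {r a b : Fin n} {S : Finset (Fin n)}

/-- The trees counted by `treesWithChildren` in which `a` and `b` are not adjacent. -/
def nonadjTrees (a b r : Fin n) (S : Finset (Fin n)) : Set (Fin n → Fin n) :=
  {p ∈ treesWithChildren r S | ¬(p a = b ∨ p b = a)}

theorem ncard_Unp_fiber (a b r : Fin n) :
    {x ∈ Unp n a b | x.2 = r}.ncard =
      ∑ S ∈ (Finset.Iio r).powerset, (nonadjTrees a b r S).ncard := by
  rw [ncard_sep_snd_eq (t := {p | IsUprooted p r ∧ ¬(p a = b ∨ p b = a)}) fun p => Iff.rfl,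
    ncard_eq_sum_fiber _ (Finset.Iio r).powerset
      (fun p => ({i | i ≠ r ∧ p i = r} : Finset (Fin n)))]
  · refine Finset.sum_congr rfl fun S hS => ?_
    congr 1
    ext p
    rw [Finset.mem_powerset] at hS
    constructor
    · rintro ⟨⟨hp, hab⟩, rfl⟩
      exact ⟨⟨hp.1, fun i hi => by simp [hi]⟩, hab⟩
    · rintro ⟨⟨hp, hS'⟩, hab⟩
      refine ⟨⟨⟨hp, fun i hi hir => ?_⟩, hab⟩, ?_⟩
      · simpa using hS ((hS' i hir).1 hi)
      · ext i
        simp only [Finset.mem_filter, Finset.mem_univ, true_and]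
        constructor
        · rintro ⟨hi, h⟩
          exact (hS' i hi).1 h
        · intro h
          have hi : i ≠ r := by simpa using (Finset.mem_Iio.1 (hS h)).ne
          exact ⟨hi, (hS' i hi).2 h⟩
  · rintro p ⟨hp, -⟩
    rw [Finset.mem_powerset]
    intro i hi
    simp only [Finset.mem_filter, Finset.mem_univ, true_and] at hi
    simpa using hp.2 i hi.2 hi.1

theorem ncard_apply_eq_of_notMem (hn : 2 ≤ n) (hr : r ∉ S) (har : a ≠ r) (hbr : b ≠ r)
    (hab : a ≠ b) (ha : a ∉ S) (hb : b ∉ S) :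
    ({p ∈ treesWithChildren r S | p a = b}.ncard : ℚ) =
      S.card * ((n - 1 : ℕ) : ℚ) ^ (n - 2) * (((n - 1 : ℕ) : ℚ)⁻¹) ^ (S.card + 1) := by
  have h1 := card_mul_ncard_not_isAncestor hr hbr (by simp [hb, hab.symm]) har ha
  rw [← ncard_apply_eq har ha hbr] at h1
  have h2 := ncard_treesWithChildren (r := r) (S := insert a S) hn (by simp [har.symm, hr])
  rw [Finset.card_insert_of_notMem ha] at h2
  have h3 : ((S.card : ℚ) + 1) * {p ∈ treesWithChildren r S | p a = b}.ncard =
      S.card * (treesWithChildren r (insert a S)).ncard := by exact_mod_cast h1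
  have hs : (S.card : ℚ) + 1 ≠ 0 := by positivity
  apply mul_left_cancel₀ hs
  rw [h3, h2]
  push_cast
  ring

theorem ncard_apply_eq_of_mem (hn : 2 ≤ n) (hr : r ∉ S) (har : a ≠ r) (hbr : b ≠ r)
    (ha : a ∉ S) (hb : b ∈ S) :
    ({p ∈ treesWithChildren r S | p a = b}.ncard : ℚ) =
      (S.card + 1) * ((n - 1 : ℕ) : ℚ) ^ (n - 2) * (((n - 1 : ℕ) : ℚ)⁻¹) ^ (S.card + 1) := by
  rw [ncard_apply_eq har ha hbr, ncard_not_isAncestor_of_mem hr hb har ha,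
    ncard_treesWithChildren hn (by simp [har.symm, hr]), Finset.card_insert_of_notMem ha]
  push_cast
  ring

theorem ncard_nonadjTrees_of_mem (hn : 2 ≤ n) (hr : r ∉ S) (har : a ≠ r) (hbr : b ≠ r)
    (ha : a ∈ S) (hb : b ∉ S) :
    ((nonadjTrees a b r S).ncard : ℚ) = ((n - 1 : ℕ) : ℚ) ^ (n - 2) *
      (S.card * (((n - 1 : ℕ) : ℚ)⁻¹) ^ S.card -
        (S.card + 1) * (((n - 1 : ℕ) : ℚ)⁻¹) ^ (S.card + 1)) := by
  have h1 : nonadjTrees a b r S = {p ∈ treesWithChildren r S | ¬p b = a} := by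
    ext p
    refine and_congr_right fun hp => not_congr (or_iff_right fun h => ?_)
    rw [(hp.2 a har).2 ha] at h
    exact hbr h.symm
  have h2 := ncard_add_ncard_not (treesWithChildren r S) (fun p => p b = a)
  rw [← h1] at h2
  have h3 := ncard_apply_eq_of_mem hn hr hbr har hb ha
  have h4 := ncard_treesWithChildren hn hr
  rw [← h2] at h4
  push_cast at h4
  linear_combination h4 - h3

theorem ncard_nonadjTrees_of_notMem (hn : 2 ≤ n) (hr : r ∉ S) (har : a ≠ r) (hbr : b ≠ r)
    (hab : a ≠ b) (ha : a ∉ S) (hb : b ∉ S) :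
    ((nonadjTrees a b r S).ncard : ℚ) = ((n - 1 : ℕ) : ℚ) ^ (n - 2) *
      (S.card * (((n - 1 : ℕ) : ℚ)⁻¹) ^ S.card -
        2 * S.card * (((n - 1 : ℕ) : ℚ)⁻¹) ^ (S.card + 1)) := by
  have h1 := ncard_add_ncard_not (treesWithChildren r S) (fun p => p a = b)
  have h2 := ncard_add_ncard_not {p ∈ treesWithChildren r S | ¬p a = b} (fun p => p b = a)
  have h3 : {p ∈ {p ∈ treesWithChildren r S | ¬p a = b} | p b = a} =
      {p ∈ treesWithChildren r S | p b = a} := by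
    ext p
    refine ⟨fun h => ⟨h.1.1, h.2⟩, fun h => ⟨⟨h.1, fun h' => ?_⟩, h.2⟩⟩
    refine h.1.1.not_isAncestor_apply har ?_
    rw [h', ← h.2]
    exact (IsAncestor.refl p b).tail
  have h4 : {p ∈ {p ∈ treesWithChildren r S | ¬p a = b} | ¬p b = a} = nonadjTrees a b r S := by
    ext p
    simp [nonadjTrees, and_assoc]
  rw [h3, h4] at h2
  have h5 := ncard_apply_eq_of_notMem hn hr har hbr hab ha hb
  have h6 := ncard_apply_eq_of_notMem hn hr hbr har hab.symm hb ha
  have h7 := ncard_treesWithChildren hn hr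
  rw [← h1, ← h2] at h7
  push_cast at h7
  linear_combination h7 - h5 - h6

theorem nonadjTrees_root_of_mem (hab : a ≠ b) (ha : a ∈ S) : nonadjTrees a b b S = ∅ := by
  rw [Set.eq_empty_iff_forall_notMem]
  rintro p ⟨hp, h⟩
  exact h (.inl ((hp.2 a hab).2 ha))

theorem nonadjTrees_root_of_notMem (hab : a ≠ b) (ha : a ∉ S) :
    nonadjTrees a b b S = treesWithChildren b S := by
  refine Set.sep_eq_self_iff_mem_true.2 fun p hp h => ?_
  rcases h with h | h
  · exact ha ((hp.2 a hab).1 h)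
  · exact hab (h.symm.trans hp.1.1)

theorem Iio_eq_insert_zero {N : ℕ} {r : Fin (N + 2)} (hr : r ≠ 0) :
    Finset.Iio r = insert 0 (Finset.Ioo 0 r) := by
  have hr' := Fin.pos_iff_ne_zero.2 hr
  ext i
  simp only [Finset.mem_Iio, Finset.mem_insert, Finset.mem_Ioo]
  have := Fin.pos_iff_ne_zero (a := i)
  grind

theorem ncard_Unp_root_zero (N : ℕ) :
    {x ∈ Unp (N + 2) 0 (Fin.last (N + 1)) | x.2 = 0}.ncard = 0 := by
  have h := ncard_treesWithChildren (r := (0 : Fin (N + 2))) (S := ∅) (by omega) (by simp)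
  have h' : (treesWithChildren (0 : Fin (N + 2)) ∅).ncard = 0 := by
    rw [Finset.card_empty, Nat.cast_zero, zero_mul, zero_mul] at h
    exact_mod_cast h
  have hI : Finset.Iio (0 : Fin (N + 2)) = ∅ := by ext; simp
  rw [ncard_Unp_fiber, hI, Finset.powerset_empty, Finset.sum_singleton, ← Nat.le_zero, ← h']
  exact Set.ncard_le_ncard (fun p hp => hp.1)

theorem ncard_Unp_root_last (N : ℕ) {y : ℚ} (hy : y = ((N + 1 : ℕ) : ℚ)⁻¹) :
    ({x ∈ Unp (N + 2) 0 (Fin.last (N + 1)) | x.2 = Fin.last (N + 1)}.ncard : ℚ) =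
      ((N + 1 : ℕ) : ℚ) ^ N * ((1 + y) ^ N * (N * y / (1 + y))) := by
  have hy0 : 0 < y := by rw [hy]; positivity
  have h0 : (0 : Fin (N + 2)) ≠ Fin.last (N + 1) := (Fin.last_pos).ne
  have hsum := sum_powerset_affine_mul_pow hy0 1 0 (Finset.Ioo 0 (Fin.last (N + 1)))
  rw [ncard_Unp_fiber, Iio_eq_insert_zero h0.symm, Finset.sum_powerset_insert (by simp)]
  have h2 : ∀ S ∈ (Finset.Ioo 0 (Fin.last (N + 1))).powerset,
      (nonadjTrees 0 (Fin.last (N + 1)) (Fin.last (N + 1)) (insert 0 S)).ncard = 0 := by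
    intro S _
    rw [nonadjTrees_root_of_mem h0 (by simp), Set.ncard_empty]
  have h1 : ∀ S ∈ (Finset.Ioo 0 (Fin.last (N + 1))).powerset,
      ((nonadjTrees 0 (Fin.last (N + 1)) (Fin.last (N + 1)) S).ncard : ℚ) =
        ((N + 1 : ℕ) : ℚ) ^ N * ((1 * S.card + 0) * y ^ S.card) := by
    intro S hS
    rw [Finset.mem_powerset] at hS
    rw [nonadjTrees_root_of_notMem h0 fun h => by simpa using hS h,
      ncard_treesWithChildren (by omega) fun h => by simpa using hS h]
    simp only [Nat.add_sub_cancel, show N + 2 - 1 = N + 1 by omega, ← hy]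
    ring
  rw [Finset.sum_eq_zero h2, add_zero]
  push_cast
  rw [Finset.sum_congr rfl h1, ← Finset.mul_sum, hsum]
  simp

theorem ncard_Unp_root_succ (N : ℕ) {y : ℚ} (hy : y = ((N + 1 : ℕ) : ℚ)⁻¹) (j : Fin N) :
    ({x ∈ Unp (N + 2) 0 (Fin.last (N + 1)) | x.2 = j.castSucc.succ}.ncard : ℚ) =
      ((N + 1 : ℕ) : ℚ) ^ N * ((1 + y) ^ (j : ℕ) *
        ((1 - y - y ^ 2) * (j : ℕ) * y / (1 + y) + (y - 2 * y ^ 2))) := by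
  have hy0 : 0 < y := by rw [hy]; positivity
  have h0 : (0 : Fin (N + 2)) ≠ Fin.last (N + 1) := (Fin.last_pos).ne
  set r : Fin (N + 2) := j.castSucc.succ with hr
  have hr0 : r ≠ 0 := Fin.succ_ne_zero _
  have hrl : r < Fin.last (N + 1) := by
    rw [Fin.lt_def]
    simp [hr]
  have hcard : (Finset.Ioo 0 r).card = j := by simp [hr]
  have hsum := sum_powerset_affine_mul_pow hy0 (1 - y - y ^ 2) (y - 2 * y ^ 2) (Finset.Ioo 0 r)
  rw [hcard] at hsum
  rw [ncard_Unp_fiber, Iio_eq_insert_zero hr0, Finset.sum_powerset_insert (by simp),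
    ← Finset.sum_add_distrib, ← hsum, Finset.mul_sum]
  push_cast
  refine Finset.sum_congr rfl fun S hS => ?_
  rw [Finset.mem_powerset] at hS
  have hS0 : 0 ∉ S := fun h => by simpa using hS h
  have hSr : r ∉ S := fun h => by simpa using hS h
  have hSl : Fin.last (N + 1) ∉ S := fun h => hrl.not_gt (Finset.mem_Ioo.1 (hS h)).2
  rw [ncard_nonadjTrees_of_notMem (by omega) hSr hr0.symm hrl.ne' h0 hS0 hSl,
    ncard_nonadjTrees_of_mem (by omega) (by simp [hr0, hSr]) hr0.symm hrl.ne' (by simp)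
      (by simp [hSl]),
    Finset.card_insert_of_notMem hS0]
  simp only [Nat.add_sub_cancel, show N + 2 - 1 = N + 1 by omega, ← hy]
  push_cast
  ring

theorem ncard_Unp (N : ℕ) :
    (N + 1) * (Unp (N + 2) 0 (Fin.last (N + 1))).ncard = N ^ 2 * (N + 1) ^ N := by
  obtain ⟨y, hy⟩ : ∃ y : ℚ, y = ((N + 1 : ℕ) : ℚ)⁻¹ := ⟨_, rfl⟩
  have hy0 : 0 < y := by rw [hy]; positivity
  have hN : (N : ℚ) * y = 1 - y := by
    rw [hy]
    push_cast
    field_simp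
    ring
  have key : ((Unp (N + 2) 0 (Fin.last (N + 1))).ncard : ℚ) =
      ((N + 1 : ℕ) : ℚ) ^ N * ((1 - y) ^ 2 / y) := by
    rw [ncard_eq_sum_fiber _ Finset.univ Prod.snd (by simp), Fin.sum_univ_succ,
      Fin.sum_univ_castSucc, ncard_Unp_root_zero]
    push_cast
    rw [Finset.sum_congr rfl fun j _ => ncard_Unp_root_succ N hy j, Fin.succ_last,
      ncard_Unp_root_last N hy, zero_add, ← Finset.mul_sum, ← mul_add,
      Fin.sum_univ_eq_sum_range
        (fun j => (1 + y) ^ j * ((1 - y - y ^ 2) * (j : ℚ) * y / (1 + y) + (y - 2 * y ^ 2))),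
      sum_range_add_eq hy0, hN]
    simp
  have : (N + 1 : ℚ) * (Unp (N + 2) 0 (Fin.last (N + 1))).ncard = N ^ 2 * (N + 1) ^ N := by
    rw [key, ← hN, hy]
    push_cast
    field_simp
  exact_mod_cast this

end Uprooted

/-- There is a bijection between `U_n'` and `A ∪ B' ∪ B''`, where `A`, `B'`, `B''` are the
indicated pairwise disjoint subsets of the set `B_n'` of rooted labelled trees on `[n]`
with `1` a non-root leaf not adjacent to `n`; in particular
`|U_n'| = |A| + |B'| + |B''|`. -/
theorem stmt12 (n : ℕ) (hn : 3 ≤ n) :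
    let v1 : Fin n := ⟨0, by omega⟩
    let vn : Fin n := ⟨n - 1, by omega⟩
    let Bn' : Set ((Fin n → Fin n) × Fin n) :=
      {p | IsRootedTree p.1 p.2 ∧ p.2 ≠ v1 ∧ (∀ i, i ≠ v1 → p.1 i ≠ v1) ∧
        ¬(p.1 v1 = vn ∨ p.1 vn = v1)}
    let A : Set ((Fin n → Fin n) × Fin n) := {p ∈ Bn' | p.2 = vn}
    let B' : Set ((Fin n → Fin n) × Fin n) :=
      {p ∈ Bn' | p.2 ≠ vn ∧ (p.1 vn = p.2 ∨ p.1 p.2 = vn) ∧ ∃ k, p.1^[k] v1 = vn}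
    let B'' : Set ((Fin n → Fin n) × Fin n) :=
      {p ∈ Bn' | p.2 ≠ vn ∧ ¬(p.1 vn = p.2 ∨ p.1 p.2 = vn)}
    Nonempty (↥(Unp n v1 vn) ≃ ↥(A ∪ B' ∪ B'')) ∧
      (Unp n v1 vn).ncard = A.ncard + B'.ncard + B''.ncard := by
  intro v1 vn Bn' A B' B''
  obtain ⟨N, rfl⟩ : ∃ N, n = N + 3 := ⟨n - 3, by omega⟩
  have hv : v1 ≠ vn := fun h => absurd (congrArg Fin.val h) (by simp [v1, vn])
  have hcard : (Unp (N + 3) v1 vn).ncard = A.ncard + B'.ncard + B''.ncard := by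
    have h1 : (N + 1 + 1) * (Unp (N + 3) v1 vn).ncard = (N + 1) ^ 2 * (N + 1 + 1) ^ (N + 1) :=
      ncard_Unp (N + 1)
    have h2 : A.ncard + B'.ncard + B''.ncard = (N + 1) ^ 2 * (N + 2) ^ N :=
      ncard_leafPairs_add hv
    rw [h2]
    refine Nat.eq_of_mul_eq_mul_left (show 0 < N + 1 + 1 by omega) (h1.trans ?_)
    ring
  refine ⟨?_, hcard⟩
  have hAB : Disjoint A B' := Set.disjoint_left.2 fun x hx hx' => hx'.2.1 hx.2
  have hABB : Disjoint (A ∪ B') B'' := Set.disjoint_left.2 fun x hx hx' =>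
    hx.elim (fun h => hx'.2.1 h.2) fun h => hx'.2.2 h.2.2.1
  refine Finite.card_eq.1 ?_
  rw [Nat.card_coe_set_eq, Nat.card_coe_set_eq, Set.ncard_union_eq hABB, Set.ncard_union_eq hAB,
    hcard]
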